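/- arXiv:1306.5729 — 5 statements merged into one kernel-verified Lean document; each statement's English description precedes it below -/
import Mathlib

section
/- Let A ∈ ℝ^{k×N} and let s be a positive integer with 2s < N. Suppose A satisfies the Restricted Isometry Property of order 2s with constant δ_{2s} < 1/3, i.e. (1 − δ_{2s})‖z‖₂² ≤ ‖Az‖₂² ≤ (1 + δ_{2s})‖z‖₂² for every 2s-sparse vector z ∈ ℝ^N. Then for every s-sparse vector z̄ ∈ ℝ^N, the optimization problem min ‖z‖₁ subject to Az = Az̄ has a unique solution, and that solution equals z̄. -/
open Matrix BigOperators

/-- The Euclidean (`ℓ₂`) norm of a finitely-indexed real vector. -/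
noncomputable def l2 {ι : Type*} [Fintype ι] (v : ι → ℝ) : ℝ := Real.sqrt (∑ i, v i ^ 2)

/-- The `ℓ₁` norm of a finitely-indexed real vector. -/
noncomputable def l1 {ι : Type*} [Fintype ι] (v : ι → ℝ) : ℝ := ∑ i, |v i|

/-- `card' v` is the number of nonzero entries of `v`. -/
noncomputable def card' {ι : Type*} (v : ι → ℝ) : ℕ := Nat.card {i : ι // v i ≠ 0}

/-- `v` is `s`-sparse if it has at most `s` nonzero entries. -/
def Sparse {ι : Type*} (s : ℕ) (v : ι → ℝ) : Prop := card' v ≤ s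

/-- `A` satisfies the Restricted Isometry Property of order `s` with constant `δ`:
`(1 - δ)‖z‖₂² ≤ ‖Az‖₂² ≤ (1 + δ)‖z‖₂²` for every `s`-sparse vector `z`. -/
def RIP {k : ℕ} {ι : Type*} [Fintype ι] (s : ℕ) (δ : ℝ) (A : Matrix (Fin k) ι ℝ) : Prop :=
  ∀ z : ι → ℝ, Sparse s z →
    (1 - δ) * l2 z ^ 2 ≤ l2 (A.mulVec z) ^ 2 ∧ l2 (A.mulVec z) ^ 2 ≤ (1 + δ) * l2 z ^ 2

lemma l2_sq_eq {ι : Type*} [Fintype ι] (v : ι → ℝ) : l2 v ^ 2 = v ⬝ᵥ v := by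
  unfold l2
  rw [Real.sq_sqrt (Finset.sum_nonneg fun i _ => sq_nonneg _)]
  simp [dotProduct, sq]

lemma sparse_of_supp {N : ℕ} (s : ℕ) (x : Fin N → ℝ) (T : Finset (Fin N))
    (hT : T.card ≤ s) (hx : ∀ i, i ∉ T → x i = 0) : Sparse s x := by
  classical
  unfold Sparse card'
  rw [Nat.card_eq_fintype_card, Fintype.card_subtype]
  refine le_trans (Finset.card_le_card ?_) hT
  intro i hi
  by_contra h
  exact (Finset.mem_filter.1 hi).2 (hx i h)

/-- Restriction of `v` to `T`. -/
def restr {N : ℕ} (v : Fin N → ℝ) (T : Finset (Fin N)) : Fin N → ℝ :=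
  fun i => if i ∈ T then v i else 0

lemma exists_top {N : ℕ} (f : Fin N → ℝ) (hf : ∀ i, 0 ≤ f i) (s : ℕ) (F : Finset (Fin N))
    (hs : 0 < s) (h : s ≤ F.card) :
    ∃ T ⊆ F, T.card = s ∧ ∃ m : ℝ, 0 ≤ m ∧ (∀ i ∈ T, m ≤ f i) ∧ ∀ j ∈ F \ T, f j ≤ m := by
  have key : ∀ s : ℕ, s ≤ F.card →
      ∃ T ⊆ F, T.card = s ∧ ∀ i ∈ T, ∀ j ∈ F \ T, f j ≤ f i := by
    intro s
    induction s with
    | zero => intro _; exact ⟨∅, by simp, by simp, by simp⟩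
    | succ n ih =>
      intro hn
      obtain ⟨T, hTF, hTc, hT⟩ := ih (by omega)
      have hne : (F \ T).Nonempty := by
        rw [← Finset.card_pos, Finset.card_sdiff_of_subset hTF]; omega
      obtain ⟨a, ha, hmax⟩ := Finset.exists_max_image (F \ T) f hne
      have ha' := Finset.mem_sdiff.1 ha
      refine ⟨insert a T, ?_, ?_, ?_⟩
      · exact Finset.insert_subset ha'.1 hTF
      · rw [Finset.card_insert_of_notMem ha'.2, hTc]
      · intro i hi j hj
        have hj' : j ∈ F \ T := by
          simp only [Finset.mem_sdiff, Finset.mem_insert, not_or] at hj ⊢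
          exact ⟨hj.1, hj.2.2⟩
        rcases Finset.mem_insert.1 hi with rfl | hi
        · exact hmax j hj'
        · exact hT i hi j hj'
  obtain ⟨T, hTF, hTc, hT⟩ := key s h
  have hne : T.Nonempty := by rw [← Finset.card_pos]; omega
  obtain ⟨a, ha, hmin⟩ := Finset.exists_min_image T f hne
  exact ⟨T, hTF, hTc, f a, hf a, hmin, fun j hj => hT a ha j hj⟩

lemma restr_dot {N : ℕ} (v : Fin N → ℝ) (T : Finset (Fin N)) :
    restr v T ⬝ᵥ restr v T = ∑ i ∈ T, v i ^ 2 := by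
  simp [dotProduct, restr, sq]

lemma inner_bound {k N : ℕ} (A : Matrix (Fin k) (Fin N) ℝ) (s : ℕ) (δ : ℝ)
    (hRIP : RIP (2 * s) δ A) (hδ : 0 ≤ δ) (v : Fin N → ℝ) (S T : Finset (Fin N))
    (hST : Disjoint S T) (hS : S.card ≤ s) (hT : T.card ≤ s) :
    |A.mulVec (restr v S) ⬝ᵥ A.mulVec (restr v T)| ≤
      δ * (Real.sqrt (∑ i ∈ S, v i ^ 2) * Real.sqrt (∑ i ∈ T, v i ^ 2)) := by
  have hX : 0 ≤ ∑ i ∈ S, v i ^ 2 := Finset.sum_nonneg fun i _ => sq_nonneg _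
  have hY : 0 ≤ ∑ i ∈ T, v i ^ 2 := Finset.sum_nonneg fun i _ => sq_nonneg _
  have h0 : restr v S ⬝ᵥ restr v T = 0 := by
    unfold dotProduct
    apply Finset.sum_eq_zero
    intro i _
    unfold restr
    by_cases hi : i ∈ S
    · have : i ∉ T := Finset.disjoint_left.1 hST hi
      simp [this]
    · simp [hi]
  have hXe := restr_dot v S
  have hYe := restr_dot v T
  have hsp : ∀ t : ℝ, Sparse (2 * s) (restr v S + t • restr v T) := by
    intro t
    apply sparse_of_supp _ _ (S ∪ T)
    · have := Finset.card_union_le S T; omega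
    · intro i hi
      rw [Finset.mem_union, not_or] at hi
      simp [restr, hi.1, hi.2]
  generalize restr v S = x at *
  generalize restr v T = y at *
  generalize (∑ i ∈ S, v i ^ 2) = X at *
  generalize (∑ i ∈ T, v i ^ 2) = Y at *
  have e1 : ∀ t : ℝ, (x + t • y) ⬝ᵥ (x + t • y) = X + t ^ 2 * Y := by
    intro t
    simp only [add_dotProduct, dotProduct_add, smul_dotProduct, dotProduct_smul, smul_eq_mul,
      hXe, hYe, h0, dotProduct_comm y x]
    ring
  have e2 : ∀ t : ℝ, A.mulVec (x + t • y) ⬝ᵥ A.mulVec (x + t • y) =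
      A.mulVec x ⬝ᵥ A.mulVec x + 2 * t * (A.mulVec x ⬝ᵥ A.mulVec y)
        + t ^ 2 * (A.mulVec y ⬝ᵥ A.mulVec y) := by
    intro t
    simp only [mulVec_add, mulVec_smul, add_dotProduct, dotProduct_add, smul_dotProduct,
      dotProduct_smul, smul_eq_mul, dotProduct_comm (A.mulVec y) (A.mulVec x)]
    ring
  generalize (A.mulVec x ⬝ᵥ A.mulVec y) = g at *
  have hq : ∀ t : ℝ, 0 ≤ (δ * Y) * (t * t) + (-2 * g) * t + δ * X := by
    intro t
    have h1 := (hRIP _ (hsp t)).2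
    have h2 := (hRIP _ (hsp (-t))).1
    rw [l2_sq_eq, l2_sq_eq, e1, e2] at h1 h2
    nlinarith
  have hd := discrim_le_zero hq
  unfold discrim at hd
  apply abs_le_of_sq_le_sq _ (by positivity)
  rw [mul_pow, mul_pow, Real.sq_sqrt hX, Real.sq_sqrt hY]
  nlinarith

lemma block_bound {k N : ℕ} (A : Matrix (Fin k) (Fin N) ℝ) (s : ℕ) (hs : 0 < s) (δ : ℝ)
    (hRIP : RIP (2 * s) δ A) (hδ : 0 ≤ δ) (v : Fin N → ℝ) (S : Finset (Fin N))
    (hS : S.card ≤ s) : ∀ (n : ℕ) (W : Finset (Fin N)) (m : ℝ), W.card ≤ n → 0 ≤ m →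
      Disjoint S W → (∀ i ∈ W, |v i| ≤ m) →
    |A.mulVec (restr v S) ⬝ᵥ A.mulVec (restr v W)| ≤
      δ * (Real.sqrt (∑ i ∈ S, v i ^ 2) * (Real.sqrt s * m + (∑ i ∈ W, |v i|) / Real.sqrt s)) := by
  have hsR : (0 : ℝ) < s := by exact_mod_cast hs
  have hr : 0 < Real.sqrt s := Real.sqrt_pos.2 hsR
  have hrr : Real.sqrt s * Real.sqrt s = s := Real.mul_self_sqrt hsR.le
  have small : ∀ (T : Finset (Fin N)) (m : ℝ), T.card ≤ s → 0 ≤ m → (∀ i ∈ T, |v i| ≤ m) →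
      Real.sqrt (∑ i ∈ T, v i ^ 2) ≤ Real.sqrt s * m := by
    intro T m hT hm h
    apply Real.sqrt_le_iff.2 ⟨by positivity, ?_⟩
    have h1 : ∑ i ∈ T, v i ^ 2 ≤ T.card • m ^ 2 :=
      Finset.sum_le_card_nsmul _ _ _ fun i hi => sq_le_sq' (by linarith [(abs_le.1 (h i hi)).1])
        (abs_le.1 (h i hi)).2
    rw [nsmul_eq_mul] at h1
    have h2 : (T.card : ℝ) ≤ s := by exact_mod_cast hT
    have := mul_le_mul_of_nonneg_right h2 (sq_nonneg m)
    rw [mul_pow, sq (Real.sqrt s), hrr]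
    linarith
  intro n
  induction n with
  | zero =>
    intro W m hW hm _ _
    have : W = ∅ := by simpa using hW
    subst this
    have : restr v ∅ = 0 := by ext; simp [restr]
    rw [this]
    simp only [mulVec_zero, dotProduct_zero, abs_zero]
    positivity
  | succ n ih =>
    intro W m hW hm hd hWm
    by_cases hc : W.card ≤ s
    · refine (inner_bound A s δ hRIP hδ v S W hd hS hc).trans ?_
      gcongr
      have := small W m hc hm hWm
      have : 0 ≤ (∑ i ∈ W, |v i|) / Real.sqrt s := by positivity
      linarith
    · obtain ⟨T, hTW, hTc, m', hm', hT1, hT2⟩ :=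
        exists_top (fun i => |v i|) (fun i => abs_nonneg _) s W hs (by omega)
      have hdT : Disjoint S T := Finset.disjoint_of_subset_right hTW hd
      have hdR : Disjoint S (W \ T) := Finset.disjoint_of_subset_right Finset.sdiff_subset hd
      have b1 := inner_bound A s δ hRIP hδ v S T hdT hS hTc.le
      have b2 := ih (W \ T) m' (by rw [Finset.card_sdiff_of_subset hTW]; omega) hm' hdR hT2
      have b3 := small T m hTc.le hm fun i hi => hWm i (hTW hi)
      have hsum : ∑ i ∈ W, |v i| = ∑ i ∈ W \ T, |v i| + ∑ i ∈ T, |v i| :=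
        (Finset.sum_sdiff hTW).symm
      have b4 : Real.sqrt s * m' ≤ (∑ i ∈ T, |v i|) / Real.sqrt s := by
        rw [le_div_iff₀ hr]
        have := Finset.card_nsmul_le_sum T (fun i => |v i|) m' hT1
        rw [nsmul_eq_mul, hTc] at this
        nlinarith
      have hsplit : restr v W = restr v T + restr v (W \ T) := by
        ext i
        by_cases h1 : i ∈ T
        · simp [restr, h1, hTW h1]
        · simp [restr, h1]
      rw [hsplit, mulVec_add, dotProduct_add, hsum, add_div]
      refine (abs_add_le _ _).trans ?_
      refine (add_le_add b1 b2).trans ?_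
      rw [← mul_add, ← mul_add]
      refine mul_le_mul_of_nonneg_left (mul_le_mul_of_nonneg_left ?_ (Real.sqrt_nonneg _)) hδ
      linarith

theorem exact_sparse_recovery_of_RIP {k N : ℕ} (A : Matrix (Fin k) (Fin N) ℝ)
    (s : ℕ) (hs : 0 < s) (hsN : 2 * s < N) (δ : ℝ) (hδ : δ < 1 / 3)
    (hRIP : RIP (2 * s) δ A) :
    ∀ zbar : Fin N → ℝ, Sparse s zbar →
      ∀ z : Fin N → ℝ, A.mulVec z = A.mulVec zbar → z ≠ zbar → l1 zbar < l1 z := by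
  classical
  intro zbar hzbar z hz hne
  have hsR : (0 : ℝ) < s := by exact_mod_cast hs
  have hr : 0 < Real.sqrt s := Real.sqrt_pos.2 hsR
  have hrr : Real.sqrt s * Real.sqrt s = s := Real.mul_self_sqrt hsR.le
  obtain ⟨v, hv⟩ : ∃ v, v = z - zbar := ⟨_, rfl⟩
  have hAv : A.mulVec v = 0 := by rw [hv, mulVec_sub, hz, sub_self]
  have hv0 : v ≠ 0 := by rw [hv]; exact sub_ne_zero.2 hne
  obtain ⟨S, -, hSc, m, hm, hS1, hS2⟩ :=
    exists_top (fun i => |v i|) (fun i => abs_nonneg _) s Finset.univ hs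
      (by simp only [Finset.card_univ, Fintype.card_fin]; omega)
  obtain ⟨i0, hi0⟩ := Function.ne_iff.1 hv0
  have hi0' : 0 < |v i0| := abs_pos.2 hi0
  -- some entry of S is nonzero
  have hXpos : 0 < ∑ i ∈ S, v i ^ 2 := by
    by_cases h : i0 ∈ S
    · exact Finset.sum_pos' (fun i _ => sq_nonneg _) ⟨i0, h, sq_pos_of_ne_zero hi0⟩
    · have h1 : |v i0| ≤ m := hS2 i0 (by simp [h])
      have hSne : S.Nonempty := by rw [← Finset.card_pos]; omega
      obtain ⟨j, hj⟩ := hSne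
      have h2 : m ≤ |v j| := hS1 j hj
      exact Finset.sum_pos' (fun i _ => sq_nonneg _)
        ⟨j, hj, sq_pos_of_ne_zero (abs_pos.1 (by linarith))⟩
  have hR := hRIP (restr v S) (sparse_of_supp _ _ S (by omega) (by
    intro i hi; simp [restr, hi]))
  rw [l2_sq_eq, l2_sq_eq, restr_dot] at hR
  have hδ0 : 0 ≤ δ := by
    by_contra h
    push Not at h
    nlinarith [hR.1.trans hR.2]
  have hb := block_bound A s hs δ hRIP hδ0 v S hSc.le _ (Finset.univ \ S) m le_rfl hm
    Finset.disjoint_sdiff hS2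
  have hsplit : v = restr v S + restr v (Finset.univ \ S) := by
    ext i
    by_cases h1 : i ∈ S
    · simp [restr, h1]
    · simp [restr, h1]
  have hAR : A.mulVec (restr v (Finset.univ \ S)) = - A.mulVec (restr v S) := by
    have : A.mulVec (restr v S) + A.mulVec (restr v (Finset.univ \ S)) = 0 := by
      rw [← mulVec_add, ← hsplit, hAv]
    exact (neg_eq_of_add_eq_zero_right this).symm
  rw [hAR, dotProduct_neg, abs_neg] at hb
  have hb1 := hR.1.trans ((le_abs_self _).trans hb)
  have hsum : ∑ i, |v i| = ∑ i ∈ Finset.univ \ S, |v i| + ∑ i ∈ S, |v i| :=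
    (Finset.sum_sdiff (Finset.subset_univ S)).symm
  have b4 : s * m ≤ ∑ i ∈ S, |v i| := by
    have := Finset.card_nsmul_le_sum S (fun i => |v i|) m hS1
    rwa [nsmul_eq_mul, hSc] at this
  obtain ⟨a, ha⟩ : ∃ a, a = Real.sqrt (∑ i ∈ S, v i ^ 2) := ⟨_, rfl⟩
  have hapos : 0 < a := by rw [ha]; exact Real.sqrt_pos.2 hXpos
  have haa : ∑ i ∈ S, v i ^ 2 = a * a := by rw [ha, Real.mul_self_sqrt hXpos.le]
  -- Cauchy-Schwarz
  have hCS : ∑ i ∈ S, |v i| ≤ Real.sqrt s * a := by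
    apply le_of_sq_le_sq _ (by positivity)
    have := sq_sum_le_card_mul_sum_sq (s := S) (f := fun i => |v i|)
    simp only [sq_abs, hSc, haa] at this
    rw [mul_pow, sq (Real.sqrt s), hrr, sq a]
    exact this
  rw [← ha, haa] at hb1
  have hb2 : Real.sqrt s * ((1 - δ) * a) ≤ δ * ∑ i, |v i| := by
    have h1 : (1 - δ) * a ≤
        δ * (Real.sqrt s * m + (∑ i ∈ Finset.univ \ S, |v i|) / Real.sqrt s) := by
      refine le_of_mul_le_mul_right ?_ hapos
      linarith
    calc Real.sqrt s * ((1 - δ) * a) ≤ Real.sqrt s *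
          (δ * (Real.sqrt s * m + (∑ i ∈ Finset.univ \ S, |v i|) / Real.sqrt s)) := by gcongr
      _ = δ * ((Real.sqrt s * Real.sqrt s) * m + ∑ i ∈ Finset.univ \ S, |v i|) := by
          field_simp
      _ ≤ δ * ∑ i, |v i| := by
          rw [hrr, hsum]
          refine mul_le_mul_of_nonneg_left ?_ hδ0
          linarith
  have hVpos : 0 < ∑ i, |v i| :=
    Finset.sum_pos' (fun i _ => abs_nonneg _) ⟨i0, Finset.mem_univ _, hi0'⟩
  have hhalf : 2 * ∑ i ∈ S, |v i| < ∑ i, |v i| := by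
    have h1 : (1 - δ) * ∑ i ∈ S, |v i| ≤ δ * ∑ i, |v i| := by
      have := mul_le_mul_of_nonneg_left hCS (show 0 ≤ 1 - δ by linarith)
      linarith
    by_contra h
    push Not at h
    nlinarith
  -- the support of zbar
  obtain ⟨U, hU⟩ : ∃ U : Finset (Fin N), U = Finset.univ.filter fun i => zbar i ≠ 0 := ⟨_, rfl⟩
  have hUc : U.card ≤ s := by
    unfold Sparse card' at hzbar
    rw [Nat.card_eq_fintype_card, Fintype.card_subtype] at hzbar
    rw [hU]; exact hzbar
  have hUS : ∑ i ∈ U, |v i| ≤ ∑ i ∈ S, |v i| := by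
    have h1 : ∑ i ∈ U, (|v i| - m) ≤ ∑ i ∈ S, (|v i| - m) := by
      rw [← Finset.sum_inter_add_sum_sdiff U S]
      have h2 : ∑ i ∈ U \ S, (|v i| - m) ≤ 0 := by
        apply Finset.sum_nonpos
        intro i hi
        have : |v i| ≤ m := hS2 i (by simp [(Finset.mem_sdiff.1 hi).2])
        linarith
      have h3 : ∑ i ∈ U ∩ S, (|v i| - m) ≤ ∑ i ∈ S, (|v i| - m) := by
        apply Finset.sum_le_sum_of_subset_of_nonneg Finset.inter_subset_right
        intro i hi _
        have : m ≤ |v i| := hS1 i hi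
        linarith
      linarith
    rw [Finset.sum_sub_distrib, Finset.sum_sub_distrib, Finset.sum_const, Finset.sum_const,
      nsmul_eq_mul, nsmul_eq_mul, hSc] at h1
    have h2 : (U.card : ℝ) ≤ s := by exact_mod_cast hUc
    have := mul_le_mul_of_nonneg_right h2 hm
    linarith
  have hpt : ∑ i, (|zbar i| + |v i| - 2 * (if i ∈ U then |v i| else 0)) ≤ ∑ i, |z i| := by
    apply Finset.sum_le_sum
    intro i _
    have hvi : v i = z i - zbar i := by rw [hv]; rfl
    by_cases hi : i ∈ U
    · simp only [hi, if_true]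
      have := abs_sub_abs_le_abs_sub (zbar i) (z i)
      rw [abs_sub_comm, ← hvi] at this
      linarith
    · have h0 : zbar i = 0 := by
        by_contra h
        exact hi (by rw [hU]; simp [h])
      simp [hi, hvi, h0]
  rw [Finset.sum_sub_distrib, Finset.sum_add_distrib, ← Finset.mul_sum] at hpt
  have hite : ∑ i, (if i ∈ U then |v i| else 0) = ∑ i ∈ U, |v i| := by simp
  rw [hite] at hpt
  unfold l1
  linarith
end

section
/- Let A = (A₁, A₂) ∈ ℝ^{k×N} with A₁ ∈ ℝ^{k×(N−r)}, A₂ ∈ ℝ^{k×r}, and r ≤ s, and suppose A satisfies the Restricted Isometry Property of order s with constant δ_s < 1. Let P = I − A₂(A₂ᵀA₂)^{−1}A₂ᵀ be the orthogonal projection onto the orthogonal complement of the range of A₂ (well-defined since A₂ has full column rank). Then the matrix P·A₁ satisfies the Restricted Isometry Property of order s − r with the same constant δ_s; that is, (1 − δ_s)‖z₁‖₂² ≤ ‖P A₁ z₁‖₂² ≤ (1 + δ_s)‖z₁‖₂² for every (s−r)-sparse vector z₁ ∈ ℝ^{N−r}. -/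
open Matrix BigOperators

lemma dot_self_nonneg' {ι : Type*} [Fintype ι] (v : ι → ℝ) : 0 ≤ v ⬝ᵥ v := by
  rw [← l2_sq_eq]; positivity

lemma mulVec_elim_eq {k Nr r : ℕ} (A : Matrix (Fin k) (Fin Nr ⊕ Fin r) ℝ)
    (z : Fin Nr → ℝ) (u : Fin r → ℝ) :
    A.mulVec (Sum.elim z u) =
      (A.submatrix id Sum.inl).mulVec z + (A.submatrix id Sum.inr).mulVec u := by
  ext i
  simp [mulVec, dotProduct, Fintype.sum_sum_type]

lemma sparse_elim {Nr r s : ℕ} (hrs : r ≤ s) (z : Fin Nr → ℝ) (hz : Sparse (s - r) z)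
    (u : Fin r → ℝ) : Sparse s (Sum.elim z u) := by
  classical
  unfold Sparse card' at *
  rw [Nat.card_eq_fintype_card, Fintype.card_subtype] at *
  have h : (Finset.univ.filter fun i => Sum.elim z u i ≠ 0) ⊆
      (Finset.univ.filter fun i => z i ≠ 0).disjSum (Finset.univ : Finset (Fin r)) := by
    intro i hi
    rcases i with i | i <;> simp_all
  have h2 := Finset.card_le_card h
  rw [Finset.card_disjSum, Finset.card_univ, Fintype.card_fin] at h2
  omega

lemma dot_elim {Nr r : ℕ} (z : Fin Nr → ℝ) (u : Fin r → ℝ) :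
    Sum.elim z u ⬝ᵥ Sum.elim z u = z ⬝ᵥ z + u ⬝ᵥ u := by
  simp [dotProduct, Fintype.sum_sum_type]

/-- If `A = (A₁, A₂)` satisfies the RIP of order `s` with constant `δ_s < 1` and
`r ≤ s`, and `P = I − A₂(A₂ᵀA₂)⁻¹A₂ᵀ` is the orthogonal projection onto the orthogonal complement
of the range of `A₂`, then `P·A₁` satisfies the RIP of order `s − r` with the same constant. -/
theorem partialRIP_of_RIP {k Nr r : ℕ} (s : ℕ) (hrs : r ≤ s) (δ : ℝ) (hδ : δ < 1)
    (A : Matrix (Fin k) (Fin Nr ⊕ Fin r) ℝ) (hRIP : RIP s δ A) :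
    RIP (s - r) δ
      (((1 : Matrix (Fin k) (Fin k) ℝ) -
          A.submatrix id Sum.inr * ((A.submatrix id Sum.inr)ᵀ * A.submatrix id Sum.inr)⁻¹ *
            (A.submatrix id Sum.inr)ᵀ) * A.submatrix id Sum.inl) := by
  have key : ∀ (z : Fin Nr → ℝ) (u : Fin r → ℝ), Sparse (s - r) z → _ :=
    fun z u hz => hRIP (Sum.elim z u) (sparse_elim hrs z hz u)
  simp only [l2_sq_eq, mulVec_elim_eq, dot_elim] at key
  generalize A.submatrix id Sum.inr = B at *
  generalize A.submatrix id Sum.inl = C at *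
  have hdet : IsUnit (Bᵀ * B).det := by
    rw [isUnit_iff_ne_zero]
    intro h0
    obtain ⟨v, hv, hv0⟩ := Matrix.exists_mulVec_eq_zero_iff.mpr h0
    have h1 := (key 0 v (by simp [Sparse, card'])).1
    have h2 : B.mulVec v ⬝ᵥ B.mulVec v = 0 := by
      rw [Matrix.dotProduct_mulVec, Matrix.vecMul_mulVec, ← Matrix.dotProduct_mulVec, hv0]
      simp
    simp only [mulVec_zero, zero_add, h2, dotProduct_zero] at h1
    have h3 : v ⬝ᵥ v ≠ 0 := fun h => hv (dotProduct_self_eq_zero.mp h)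
    have h4 := lt_of_le_of_ne (dot_self_nonneg' v) (Ne.symm h3)
    nlinarith
  intro z hz
  rw [l2_sq_eq, l2_sq_eq]
  set u : Fin r → ℝ := -((Bᵀ * B)⁻¹ *ᵥ (Bᵀ *ᵥ (C *ᵥ z))) with hu
  have hP : ((1 - B * (Bᵀ * B)⁻¹ * Bᵀ) * C) *ᵥ z = C *ᵥ z + B *ᵥ u := by
    simp only [hu, ← mulVec_mulVec, sub_mulVec, one_mulVec, mulVec_neg]
    rw [sub_eq_add_neg]
  rw [hP]
  have horth : Bᵀ *ᵥ (C *ᵥ z + B *ᵥ u) = 0 := by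
    rw [mulVec_add, mulVec_mulVec (M := Bᵀ) (N := B), hu, mulVec_neg,
      mulVec_mulVec (M := Bᵀ * B) (N := (Bᵀ * B)⁻¹),
      Matrix.mul_nonsing_inv _ hdet, one_mulVec, add_neg_cancel]
  have hz1 := (key z u hz).1
  have hz2 := (key z 0 hz).2
  have hw : (B *ᵥ u) ⬝ᵥ (C *ᵥ z + B *ᵥ u) = 0 := by
    rw [dotProduct_comm, dotProduct_mulVec, ← mulVec_transpose, horth, zero_dotProduct]
  have hn := dot_self_nonneg' (B *ᵥ u)
  have hun := dot_self_nonneg' u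
  simp only [mulVec_zero, add_zero, dotProduct_zero] at hz2
  constructor
  · nlinarith
  · have hc := dotProduct_comm (B *ᵥ u) (C *ᵥ z)
    simp only [add_dotProduct, dotProduct_add] at hw ⊢
    linarith
end

section
/- Let Δ > 0, n ≥ 1, and let m(x) = Σ_ι α_ι ψ_ι(x) be a quadratic function with coefficient vector α ∈ ℝ^{(n+1)(n+2)/2} in the basis ψ. Then for all x ∈ [−Δ,Δ]^n, the gradient of m satisfies ‖∇m(x)‖₂ ≤ 3√5·√(card(α))·(1/Δ)·‖α‖₂, where card(α) is the number of nonzero entries of α. -/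
open Matrix BigOperators MeasureTheory

/-- Index set for the degree-2 "off-diagonal" basis elements: pairs `i < j`. -/
abbrev Pairs (n : ℕ) := {p : Fin n × Fin n // p.1 < p.2}

/-- Index set for the quadratic part `ψ_Q` of the basis: diagonal terms and pairs `i < j`. -/
abbrev QIdx (n : ℕ) := Fin n ⊕ Pairs n

/-- Index set for the affine part `ψ_L` of the basis: linear terms and the constant term. -/
abbrev LIdx (n : ℕ) := Fin n ⊕ Unit

/-- Index set for the whole basis `ψ`, of cardinality `(n+1)(n+2)/2`. -/
abbrev Idx (n : ℕ) := QIdx n ⊕ LIdx n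

/-- The orthonormal quadratic basis `ψ` on the hypercube `[−Δ,Δ]^n`:
`ψ_{2,i}(x) = (3√5/(2Δ²))x_i² − √5/2`, `ψ_{2,ij}(x) = (3/Δ²)x_i x_j` (`i < j`),
`ψ_{1,i}(x) = (√3/Δ)x_i`, and `ψ_0(x) = 1`. -/
noncomputable def psi (n : ℕ) (Δ : ℝ) : Idx n → (Fin n → ℝ) → ℝ
  | Sum.inl (Sum.inl i) => fun x => 3 * Real.sqrt 5 / (2 * Δ ^ 2) * x i ^ 2 - Real.sqrt 5 / 2
  | Sum.inl (Sum.inr p) => fun x => 3 / Δ ^ 2 * (x p.1.1 * x p.1.2)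
  | Sum.inr (Sum.inl i) => fun x => Real.sqrt 3 / Δ * x i
  | Sum.inr (Sum.inr _) => fun _ => 1

/-- The hypercube `B_∞(0;Δ) = [−Δ,Δ]^n`. -/
def cube (n : ℕ) (Δ : ℝ) : Set (Fin n → ℝ) := {x | ∀ i, |x i| ≤ Δ}

/-- The uniform probability measure `μ` on the hypercube `[−Δ,Δ]^n`. -/
noncomputable def mu (n : ℕ) (Δ : ℝ) : MeasureTheory.Measure (Fin n → ℝ) :=
  (ENNReal.ofReal ((2 * Δ) ^ n))⁻¹ •
    MeasureTheory.Measure.pi (fun _ : Fin n => MeasureTheory.volume.restrict (Set.Icc (-Δ) Δ))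

/-- The gradient of `f : ℝ^n → ℝ` at `x`, as the vector of partial derivatives. -/
noncomputable def grad {n : ℕ} (f : (Fin n → ℝ) → ℝ) (x : Fin n → ℝ) : Fin n → ℝ :=
  fun i => fderiv ℝ f x (Pi.single i 1)

lemma psi_grad_bound (n : ℕ) (Δ : ℝ) (hΔ : 0 < Δ) (x : Fin n → ℝ) (hx : x ∈ cube n Δ)
    (ι : Idx n) : ∃ L : (Fin n → ℝ) →L[ℝ] ℝ, HasFDerivAt (psi n Δ ι) L x ∧
      ∑ k, (L (Pi.single k 1)) ^ 2 ≤ 45 / Δ ^ 2 := by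
  have hpr : ∀ i : Fin n, HasFDerivAt (fun y : Fin n → ℝ => y i)
      (ContinuousLinearMap.proj (R := ℝ) (φ := fun _ : Fin n => ℝ) i) x :=
    fun i => hasFDerivAt_apply i x
  have hsq : ∀ i, x i ^ 2 ≤ Δ ^ 2 := fun i => sq_le_sq' (abs_le.1 (hx i)).1 (abs_le.1 (hx i)).2
  have h5 : Real.sqrt 5 ^ 2 = 5 := Real.sq_sqrt (by norm_num)
  have h3 : Real.sqrt 3 ^ 2 = 3 := Real.sq_sqrt (by norm_num)
  have hD : 0 < Δ ^ 2 := by positivity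
  rcases ι with (i | p) | (i | u)
  · refine ⟨_, (((hpr i).pow 2).const_mul (3 * Real.sqrt 5 / (2 * Δ ^ 2))).sub_const
      (Real.sqrt 5 / 2), ?_⟩
    rw [Finset.sum_eq_single i]
    · simp
      have : (3 * Real.sqrt 5 / (2 * Δ ^ 2) * (2 * x i)) ^ 2 = 45 * x i ^ 2 / (Δ ^ 2) ^ 2 := by
        field_simp
        rw [h5]; ring
      rw [this, div_le_div_iff₀ (by positivity) hD]
      nlinarith [mul_le_mul_of_nonneg_right (hsq i) hD.le]
    · intro k _ hk
      simp [Pi.single_apply, hk.symm]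
    · simp
  · obtain ⟨⟨i, j⟩, hij⟩ := p
    have hne : i ≠ j := ne_of_lt hij
    refine ⟨_, ((hpr i).mul (hpr j)).const_mul (3 / Δ ^ 2), ?_⟩
    rw [← Finset.sum_subset (Finset.subset_univ {i, j})]
    · rw [Finset.sum_pair hne]
      simp [Pi.single_apply, hne, hne.symm]
      have : (3 / Δ ^ 2 * x j) ^ 2 + (3 / Δ ^ 2 * x i) ^ 2
          = 9 * (x i ^ 2 + x j ^ 2) / (Δ ^ 2) ^ 2 := by
        field_simp; ring
      rw [this, div_le_div_iff₀ (by positivity) hD]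
      nlinarith [mul_le_mul_of_nonneg_right (hsq i) hD.le,
        mul_le_mul_of_nonneg_right (hsq j) hD.le, mul_pos hD hD]
    · intro k _ hk
      simp at hk
      simp [Pi.single_apply, Ne.symm hk.1, Ne.symm hk.2]
  · refine ⟨_, (hpr i).const_mul (Real.sqrt 3 / Δ), ?_⟩
    rw [Finset.sum_eq_single i]
    · simp [div_pow]
      gcongr
      norm_num
    · intro k _ hk
      simp [Pi.single_apply, hk.symm]
    · simp
  · refine ⟨0, hasFDerivAt_const _ _, ?_⟩
    simp
    positivity

/-- For a quadratic `m = Σ_ι α_ι ψ_ι`, the gradient satisfies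
`‖∇m(x)‖₂ ≤ 3√5·√(card(α))·(1/Δ)·‖α‖₂` for all `x ∈ [−Δ,Δ]^n`. -/
theorem grad_le_of_coeffs (n : ℕ) (hn : 1 ≤ n) (Δ : ℝ) (hΔ : 0 < Δ) (α : Idx n → ℝ)
    (x : Fin n → ℝ) (hx : x ∈ cube n Δ) :
    l2 (grad (fun y => ∑ ι, α ι * psi n Δ ι y) x) ≤
      3 * Real.sqrt 5 * Real.sqrt (card' α) * (1 / Δ) * l2 α := by
  classical
  choose L hL hb using psi_grad_bound n Δ hΔ x hx
  have hg : ∀ k, grad (fun y => ∑ ι, α ι * psi n Δ ι y) x k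
      = ∑ ι, α ι * L ι (Pi.single k 1) := by
    intro k
    have h : HasFDerivAt (fun y => ∑ ι, α ι * psi n Δ ι y) (∑ ι, α ι • L ι) x :=
      HasFDerivAt.fun_sum fun ι _ => (hL ι).const_mul (α ι)
    unfold grad
    rw [h.fderiv]
    simp [ContinuousLinearMap.sum_apply]
  have hcard : card' α = (Finset.univ.filter fun ι => α ι ≠ 0).card := by
    unfold card'
    rw [Nat.card_eq_fintype_card, Fintype.card_subtype]
  have hk : ∀ k, (∑ ι, α ι * L ι (Pi.single k 1)) ^ 2 ≤
      card' α * ∑ ι, α ι ^ 2 * L ι (Pi.single k 1) ^ 2 := by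
    intro k
    have e : ∑ ι, α ι * L ι (Pi.single k 1)
        = ∑ ι ∈ Finset.univ.filter (fun ι => α ι ≠ 0), α ι * L ι (Pi.single k 1) := by
      rw [Finset.sum_filter]
      refine Finset.sum_congr rfl fun ι _ => ?_
      by_cases h : α ι = 0 <;> simp [h]
    rw [e, hcard]
    refine sq_sum_le_card_mul_sum_sq.trans ?_
    refine mul_le_mul_of_nonneg_left ?_ (by positivity)
    simp only [mul_pow]
    exact Finset.sum_le_sum_of_subset_of_nonneg (Finset.subset_univ _)
      fun _ _ _ => by positivity
  have hS : 0 ≤ ∑ ι, α ι ^ 2 := Finset.sum_nonneg fun _ _ => sq_nonneg _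
  unfold l2
  refine Real.sqrt_le_iff.2 ⟨by positivity, ?_⟩
  have hr : (3 * Real.sqrt 5 * Real.sqrt (card' α) * (1 / Δ) * Real.sqrt (∑ ι, α ι ^ 2)) ^ 2
      = card' α * ∑ ι, α ι ^ 2 * (45 / Δ ^ 2) := by
    rw [← Finset.sum_mul]
    simp only [mul_pow, div_pow]
    rw [Real.sq_sqrt hS, Real.sq_sqrt (Nat.cast_nonneg _), Real.sq_sqrt (by norm_num)]
    ring
  rw [hr]
  calc _ ≤ ∑ k, (card' α : ℝ) * ∑ ι, α ι ^ 2 * L ι (Pi.single k 1) ^ 2 :=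
        Finset.sum_le_sum fun k _ => by rw [hg]; exact hk k
    _ = card' α * ∑ ι, α ι ^ 2 * ∑ k, L ι (Pi.single k 1) ^ 2 := by
        rw [← Finset.mul_sum, Finset.sum_comm]
        simp only [Finset.mul_sum]
    _ ≤ _ := by
        refine mul_le_mul_of_nonneg_left ?_ (Nat.cast_nonneg _)
        exact Finset.sum_le_sum fun ι _ => mul_le_mul_of_nonneg_left (hb ι) (sq_nonneg _)
end

section
/- Let Δ > 0, n ≥ 1, and let m(x) = Σ_ι α_ι ψ_ι(x) be a quadratic function with coefficient vector α ∈ ℝ^{(n+1)(n+2)/2} in the basis ψ. Then the Hessian of m satisfies ‖∇²m(x)‖₂ ≤ ‖∇²m(x)‖_F ≤ 3√5·√(card(α))·(1/Δ²)·‖α‖₂ for all x ∈ [−Δ,Δ]^n, where ‖·‖₂ denotes the spectral norm, ‖·‖_F the Frobenius norm, and card(α) is the number of nonzero entries of α. -/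
open Matrix BigOperators MeasureTheory

/-- The Hessian of `f : ℝ^n → ℝ` at `x`, as the matrix of second partial derivatives. -/
noncomputable def hess {n : ℕ} (f : (Fin n → ℝ) → ℝ) (x : Fin n → ℝ) :
    Matrix (Fin n) (Fin n) ℝ :=
  fun i j => fderiv ℝ (fun y => fderiv ℝ f y (Pi.single j 1)) x (Pi.single i 1)

/-- The Frobenius norm of a matrix. -/
noncomputable def frobNorm {n : ℕ} (H : Matrix (Fin n) (Fin n) ℝ) : ℝ :=
  Real.sqrt (∑ i, ∑ j, H i j ^ 2)

/-- The spectral norm (`ℓ₂`-operator norm) of a matrix. -/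
noncomputable def specNorm {n : ℕ} (H : Matrix (Fin n) (Fin n) ℝ) : ℝ :=
  sSup ((fun v => l2 (H.mulVec v)) '' {v | l2 v ≤ 1})

theorem spec_le_frob {n : ℕ} (H : Matrix (Fin n) (Fin n) ℝ) : specNorm H ≤ frobNorm H := by
  unfold specNorm
  apply Real.sSup_le
  · rintro _ ⟨v, hv, rfl⟩
    have hv1 : ∑ i, v i ^ 2 ≤ 1 := by
      have h : Real.sqrt (∑ i, v i ^ 2) ≤ 1 := hv
      simpa using (Real.sqrt_le_left (by norm_num)).1 h
    show Real.sqrt _ ≤ Real.sqrt _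
    apply Real.sqrt_le_sqrt
    apply Finset.sum_le_sum
    intro i _
    have h1 := Finset.sum_mul_sq_le_sq_mul_sq Finset.univ (H i) v
    have h2 : 0 ≤ ∑ j, H i j ^ 2 := Finset.sum_nonneg fun _ _ => sq_nonneg _
    simp only [Matrix.mulVec, dotProduct]
    nlinarith
  · exact Real.sqrt_nonneg _

/-- First partial derivatives of the basis. -/
noncomputable def dpsi (n : ℕ) (Δ : ℝ) (j : Fin n) : Idx n → (Fin n → ℝ) → ℝ
  | Sum.inl (Sum.inl k) => fun x => 3 * Real.sqrt 5 / Δ ^ 2 * (if k = j then 1 else 0) * x k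
  | Sum.inl (Sum.inr p) => fun x => 3 / Δ ^ 2 *
      ((if p.1.1 = j then 1 else 0) * x p.1.2 + (if p.1.2 = j then 1 else 0) * x p.1.1)
  | Sum.inr (Sum.inl k) => fun _ => Real.sqrt 3 / Δ * (if k = j then 1 else 0)
  | Sum.inr (Sum.inr _) => fun _ => 0

/-- Second partial derivatives of the basis. -/
noncomputable def ddpsi (n : ℕ) (Δ : ℝ) (i j : Fin n) : Idx n → ℝ
  | Sum.inl (Sum.inl k) =>
      3 * Real.sqrt 5 / Δ ^ 2 * (if k = j then 1 else 0) * (if k = i then 1 else 0)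
  | Sum.inl (Sum.inr p) => 3 / Δ ^ 2 *
      ((if p.1.1 = j then 1 else 0) * (if p.1.2 = i then 1 else 0)
        + (if p.1.2 = j then 1 else 0) * (if p.1.1 = i then 1 else 0))
  | Sum.inr _ => 0

theorem hasFDerivAt_coord {n : ℕ} (k : Fin n) (y : Fin n → ℝ) :
    HasFDerivAt (fun z : Fin n → ℝ => z k) (ContinuousLinearMap.proj (R := ℝ) (φ := fun _ : Fin n => ℝ) k) y :=
  (ContinuousLinearMap.proj (R := ℝ) (φ := fun _ : Fin n => ℝ) k).hasFDerivAt

theorem differentiable_psi (n : ℕ) (Δ : ℝ) (ι : Idx n) : Differentiable ℝ (psi n Δ ι) := by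
  rcases ι with (k | p) | (k | u) <;> unfold psi <;> fun_prop

theorem differentiable_dpsi (n : ℕ) (Δ : ℝ) (j : Fin n) (ι : Idx n) :
    Differentiable ℝ (dpsi n Δ j ι) := by
  rcases ι with (k | p) | (k | u) <;> unfold dpsi <;> fun_prop

theorem fderiv_psi (n : ℕ) (Δ : ℝ) (j : Fin n) (ι : Idx n) (y : Fin n → ℝ) :
    fderiv ℝ (psi n Δ ι) y (Pi.single j 1) = dpsi n Δ j ι y := by
  rcases ι with (k | p) | (k | u)
  · have h := (((hasFDerivAt_coord k y).pow 2).const_mul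
      (3 * Real.sqrt 5 / (2 * Δ ^ 2))).sub_const (Real.sqrt 5 / 2)
    have h' : fderiv ℝ (psi n Δ (Sum.inl (Sum.inl k))) y = _ := h.fderiv
    rw [h']
    simp [dpsi, Pi.single_apply]
    split_ifs <;> ring
  · have h := (((hasFDerivAt_coord p.1.1 y).mul (hasFDerivAt_coord p.1.2 y)).const_mul
      (3 / Δ ^ 2))
    have h' : fderiv ℝ (psi n Δ (Sum.inl (Sum.inr p))) y = _ := h.fderiv
    rw [h']
    simp [dpsi, Pi.single_apply]
    split_ifs <;> ring
  · have h := (hasFDerivAt_coord k y).const_mul (Real.sqrt 3 / Δ)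
    have h' : fderiv ℝ (psi n Δ (Sum.inr (Sum.inl k))) y = _ := h.fderiv
    rw [h']
    simp [dpsi, Pi.single_apply]
  · have h' : fderiv ℝ (psi n Δ (Sum.inr (Sum.inr u))) y = _ :=
      (hasFDerivAt_const (1 : ℝ) y).fderiv
    rw [h']
    simp [dpsi]

theorem fderiv_dpsi (n : ℕ) (Δ : ℝ) (i j : Fin n) (ι : Idx n) (y : Fin n → ℝ) :
    fderiv ℝ (dpsi n Δ j ι) y (Pi.single i 1) = ddpsi n Δ i j ι := by
  rcases ι with (k | p) | (k | u)
  · have h := (hasFDerivAt_coord k y).const_mul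
      (3 * Real.sqrt 5 / Δ ^ 2 * (if k = j then 1 else 0))
    have h' : fderiv ℝ (dpsi n Δ j (Sum.inl (Sum.inl k))) y = _ := h.fderiv
    rw [h']
    simp only [ddpsi]
    split_ifs <;> simp_all [Pi.single_apply] <;> ring
  · have h := (((hasFDerivAt_coord p.1.2 y).const_mul (if p.1.1 = j then (1 : ℝ) else 0)).add
      ((hasFDerivAt_coord p.1.1 y).const_mul (if p.1.2 = j then (1 : ℝ) else 0))).const_mul
      (3 / Δ ^ 2)
    have h' : fderiv ℝ (dpsi n Δ j (Sum.inl (Sum.inr p))) y = _ := h.fderiv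
    rw [h']
    simp only [ddpsi]
    split_ifs <;> simp_all [Pi.single_apply] <;> ring
  · have h' : fderiv ℝ (dpsi n Δ j (Sum.inr (Sum.inl k))) y = _ :=
      (hasFDerivAt_const (Real.sqrt 3 / Δ * (if k = j then (1 : ℝ) else 0)) y).fderiv
    rw [h']
    simp [ddpsi]
  · have h' : fderiv ℝ (dpsi n Δ j (Sum.inr (Sum.inr u))) y = _ :=
      (hasFDerivAt_const (0 : ℝ) y).fderiv
    rw [h']
    simp [ddpsi]

theorem fderiv_comb {n : ℕ} (α : Idx n → ℝ) (g : Idx n → (Fin n → ℝ) → ℝ)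
    (hg : ∀ ι, Differentiable ℝ (g ι)) (y v : Fin n → ℝ) :
    fderiv ℝ (fun y => ∑ ι, α ι * g ι y) y v = ∑ ι, α ι * fderiv ℝ (g ι) y v := by
  have h := HasFDerivAt.fun_sum (u := Finset.univ)
    (fun ι _ => ((hg ι y).hasFDerivAt).const_mul (α ι))
  rw [h.fderiv]
  simp

theorem hess_eq {n : ℕ} (Δ : ℝ) (α : Idx n → ℝ) (x : Fin n → ℝ) (i j : Fin n) :
    hess (fun y => ∑ ι, α ι * psi n Δ ι y) x i j = ∑ ι, α ι * ddpsi n Δ i j ι := by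
  unfold hess
  have h : (fun y => fderiv ℝ (fun y => ∑ ι, α ι * psi n Δ ι y) y (Pi.single j 1))
      = fun y => ∑ ι, α ι * dpsi n Δ j ι y := by
    funext y
    rw [fderiv_comb α _ (differentiable_psi n Δ)]
    simp only [fderiv_psi]
  rw [h, fderiv_comb α _ (differentiable_dpsi n Δ j)]
  simp only [fderiv_dpsi]

/-- The strictly upper triangular matrix of the pair coefficients. -/
noncomputable def upper {n : ℕ} (α : Idx n → ℝ) (i j : Fin n) : ℝ :=
  if h : i < j then α (Sum.inl (Sum.inr ⟨(i, j), h⟩)) else 0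

theorem sum_pairs {n : ℕ} (α : Idx n → ℝ) (i j : Fin n) :
    ∑ p : Pairs n, α (Sum.inl (Sum.inr p)) *
      ((if p.1.1 = i then 1 else 0) * (if p.1.2 = j then 1 else 0)) = upper α i j := by
  unfold upper
  split_ifs with h
  · rw [Finset.sum_eq_single ⟨(i, j), h⟩]
    · simp
    · rintro ⟨⟨a, b⟩, hp⟩ _ hne
      by_cases h1 : a = i
      · by_cases h2 : b = j
        · subst h1 h2; exact absurd rfl hne
        · simp [h2]
      · simp [h1]
    · simp
  · apply Finset.sum_eq_zero
    rintro ⟨⟨a, b⟩, hp⟩ _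
    by_cases h1 : a = i
    · by_cases h2 : b = j
      · subst h1 h2; exact absurd hp h
      · simp [h2]
    · simp [h1]

theorem sum_upper_sq {n : ℕ} (α : Idx n → ℝ) :
    ∑ i, ∑ j, upper α i j ^ 2 = ∑ p : Pairs n, α (Sum.inl (Sum.inr p)) ^ 2 := by
  rw [← Fintype.sum_prod_type' (fun i j => upper α i j ^ 2)]
  rw [← Finset.sum_subset (Finset.subset_univ
    (Finset.univ.filter fun p : Fin n × Fin n => p.1 < p.2))]
  · rw [Finset.sum_subtype (p := fun p : Fin n × Fin n => p.1 < p.2) _ (by simp)]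
    apply Finset.sum_congr rfl
    rintro ⟨p, hp⟩ _
    simp [upper, hp]
  · intro p _ hp
    have hp' : ¬ p.1 < p.2 := by simpa using hp
    simp [upper, hp']

theorem hess_eq' {n : ℕ} (Δ : ℝ) (α : Idx n → ℝ) (x : Fin n → ℝ) (i j : Fin n) :
    hess (fun y => ∑ ι, α ι * psi n Δ ι y) x i j =
      3 * Real.sqrt 5 / Δ ^ 2 * (if i = j then α (Sum.inl (Sum.inl i)) else 0)
      + 3 / Δ ^ 2 * (upper α i j + upper α j i) := by
  rw [hess_eq, Fintype.sum_sum_type, Fintype.sum_sum_type]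
  rw [← sum_pairs, ← sum_pairs, ← Finset.sum_add_distrib, Finset.mul_sum]
  have h0 : ∑ q : LIdx n, α (Sum.inr q) * ddpsi n Δ i j (Sum.inr q) = 0 :=
    Finset.sum_eq_zero fun q _ => by simp [ddpsi]
  rw [h0, add_zero]
  congr 1
  · rw [Finset.sum_eq_single i]
    · simp only [ddpsi, if_true]
      split_ifs <;> ring
    · intro b _ hb
      simp [ddpsi, hb]
    · simp
  · apply Finset.sum_congr rfl
    intro p _
    simp only [ddpsi]
    ring

theorem hess_sq {n : ℕ} (Δ : ℝ) (α : Idx n → ℝ) (x : Fin n → ℝ) (i j : Fin n) :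
    hess (fun y => ∑ ι, α ι * psi n Δ ι y) x i j ^ 2 =
      45 / Δ ^ 4 * (if i = j then α (Sum.inl (Sum.inl i)) ^ 2 else 0)
      + 9 / Δ ^ 4 * (upper α i j ^ 2 + upper α j i ^ 2) := by
  rw [hess_eq']
  have h5 : Real.sqrt 5 ^ 2 = 5 := Real.sq_sqrt (by norm_num)
  rcases lt_trichotomy i j with h | h | h
  · simp only [upper, h, h.ne, h.not_gt, if_false, dif_pos, dif_neg, not_false_eq_true]
    ring
  · subst h
    simp only [upper, lt_irrefl, if_true, dif_neg, not_false_eq_true]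
    ring_nf
    rw [h5]
    ring
  · simp only [upper, h, h.ne', h.not_gt, if_false, dif_pos, dif_neg, not_false_eq_true]
    ring

theorem frob_sq_le {n : ℕ} (Δ : ℝ) (α : Idx n → ℝ) (x : Fin n → ℝ) :
    ∑ i, ∑ j, hess (fun y => ∑ ι, α ι * psi n Δ ι y) x i j ^ 2 ≤
      45 / Δ ^ 4 * ∑ ι, α ι ^ 2 := by
  simp only [hess_sq, Finset.sum_add_distrib, ← Finset.mul_sum]
  rw [Finset.sum_comm (f := fun i j => upper α j i ^ 2), sum_upper_sq]
  simp only [Finset.sum_ite_eq, Finset.mem_univ, if_true]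
  rw [Fintype.sum_sum_type, Fintype.sum_sum_type]
  have h1 : 0 ≤ ∑ p : Pairs n, α (Sum.inl (Sum.inr p)) ^ 2 :=
    Finset.sum_nonneg fun _ _ => sq_nonneg _
  have h2 : 0 ≤ ∑ q : LIdx n, α (Sum.inr q) ^ 2 :=
    Finset.sum_nonneg fun _ _ => sq_nonneg _
  have h3 : 0 ≤ 1 / Δ ^ 4 := by positivity
  have h4 := mul_nonneg h3 h1
  have h5 := mul_nonneg h3 h2
  rw [div_eq_mul_one_div 45, div_eq_mul_one_div 9]
  nlinarith

/-- For a quadratic `m = Σ_ι α_ι ψ_ι`, the Hessian satisfies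
`‖∇²m(x)‖₂ ≤ ‖∇²m(x)‖_F ≤ 3√5·√(card(α))·(1/Δ²)·‖α‖₂` for all `x ∈ [−Δ,Δ]^n`. -/
theorem hess_le_of_coeffs (n : ℕ) (hn : 1 ≤ n) (Δ : ℝ) (hΔ : 0 < Δ) (α : Idx n → ℝ)
    (x : Fin n → ℝ) (hx : x ∈ cube n Δ) :
    specNorm (hess (fun y => ∑ ι, α ι * psi n Δ ι y) x) ≤
        frobNorm (hess (fun y => ∑ ι, α ι * psi n Δ ι y) x) ∧
      frobNorm (hess (fun y => ∑ ι, α ι * psi n Δ ι y) x) ≤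
        3 * Real.sqrt 5 * Real.sqrt (card' α) * (1 / Δ ^ 2) * l2 α := by
  refine ⟨spec_le_frob _, ?_⟩
  have hF := frob_sq_le Δ α x
  have hl : l2 α ^ 2 = ∑ ι, α ι ^ 2 :=
    Real.sq_sqrt (Finset.sum_nonneg fun _ _ => sq_nonneg _)
  have hl0 : 0 ≤ l2 α := Real.sqrt_nonneg _
  have h5 : Real.sqrt 5 ^ 2 = 5 := Real.sq_sqrt (by norm_num)
  have h1 : frobNorm (hess (fun y => ∑ ι, α ι * psi n Δ ι y) x) ≤
      3 * Real.sqrt 5 * (1 / Δ ^ 2) * l2 α := by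
    apply Real.sqrt_le_iff.2
    refine ⟨by positivity, hF.trans (le_of_eq ?_)⟩
    rw [mul_pow, mul_pow, mul_pow, h5, hl]
    ring
  refine h1.trans ?_
  by_cases hα : ∃ ι, α ι ≠ 0
  · obtain ⟨ι, hι⟩ := hα
    have hc : 1 ≤ card' α := by
      haveI : Nonempty {i // α i ≠ 0} := ⟨⟨ι, hι⟩⟩
      exact Nat.card_pos
    have hs : 1 ≤ Real.sqrt (card' α) := Real.one_le_sqrt.2 (by exact_mod_cast hc)
    have hp : 0 ≤ 3 * Real.sqrt 5 * (1 / Δ ^ 2) * l2 α := by positivity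
    nlinarith
  · push Not at hα
    have : l2 α = 0 := by simp [l2, hα]
    rw [this]
    simp
end

section
/- Let Δ > 0 and n ≥ 2, and consider the quadratic function g(x) = Σ_{1 ≤ i < j ≤ n} √(2/(n(n−1)))·(3/Δ²)·x_i x_j. Its coefficient vector α in the basis ψ (namely α_{2,ij} = √(2/(n(n−1))) for all i < j and all other coefficients zero) satisfies ‖α‖₂ = 1 and card(α) = n(n−1)/2, and g(Δ, …, Δ) = 3·√(n(n−1)/2) = 3·√(card(α)). Hence the dependence on √(card(α)) in the bound |m(x)| ≤ 3√(card(α))‖α‖₂ over [−Δ,Δ]^n cannot be eliminated. -/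
open Matrix BigOperators MeasureTheory

/-- The coefficient vector of `g(x) = Σ_{i<j} √(2/(n(n−1)))·(3/Δ²)·x_i x_j` in the basis `ψ`:
`α_{2,ij} = √(2/(n(n−1)))` for `i < j`, all other coefficients zero. -/
noncomputable def gCoeff (n : ℕ) : Idx n → ℝ :=
  Sum.elim (Sum.elim 0 (fun _ => Real.sqrt (2 / ((n : ℝ) * ((n : ℝ) - 1))))) 0

theorem card_pairs_aux (n : ℕ) : Fintype.card (Pairs n) = n * (n - 1) / 2 := by
  rw [Fintype.card_subtype, Finset.card_filter, Fintype.sum_prod_type_right]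
  have h : ∀ j : Fin n, (∑ i : Fin n, if i < j then 1 else 0) = (j : ℕ) := by
    intro j
    rw [← Finset.card_filter]
    have : (Finset.univ.filter (fun i : Fin n => i < j)) = Finset.Iio j := by
      ext i; simp
    rw [this, Fin.card_Iio]
  simp only [h]
  rw [Fin.sum_univ_eq_sum_range (fun i => i) n, Finset.sum_range_id]

theorem card_pairs_real_aux (n : ℕ) (hn : 2 ≤ n) :
    ((n * (n - 1) / 2 : ℕ) : ℝ) = (n : ℝ) * ((n : ℝ) - 1) / 2 := by
  rw [← Nat.choose_two_right, Nat.cast_choose_two]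

/-- For `n ≥ 2`, the quadratic `g = Σ_ι α_ι ψ_ι` with coefficients `gCoeff n`
satisfies `‖α‖₂ = 1`, `card(α) = n(n−1)/2`, and
`g(Δ,…,Δ) = 3·√(n(n−1)/2) = 3·√(card(α))`; hence the `√(card(α))` dependence in the bound
`|m(x)| ≤ 3√(card(α))‖α‖₂` over `[−Δ,Δ]^n` cannot be eliminated. -/
theorem sharpness_of_cardinality_bound (n : ℕ) (hn : 2 ≤ n) (Δ : ℝ) (hΔ : 0 < Δ) :
    l2 (gCoeff n) = 1 ∧
    card' (gCoeff n) = n * (n - 1) / 2 ∧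
    (∑ ι, gCoeff n ι * psi n Δ ι (fun _ => Δ)) =
      3 * Real.sqrt ((n : ℝ) * ((n : ℝ) - 1) / 2) ∧
    (∑ ι, gCoeff n ι * psi n Δ ι (fun _ => Δ)) = 3 * Real.sqrt (card' (gCoeff n)) := by
  have hn' : (2 : ℝ) ≤ n := by exact_mod_cast hn
  have hN : 0 < (n : ℝ) * ((n : ℝ) - 1) := mul_pos (by linarith) (by linarith)
  have hc : 0 < Real.sqrt (2 / ((n : ℝ) * ((n : ℝ) - 1))) :=
    Real.sqrt_pos.mpr (div_pos two_pos hN)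
  have hP : (Fintype.card (Pairs n) : ℝ) = (n : ℝ) * ((n : ℝ) - 1) / 2 := by
    rw [card_pairs_aux, card_pairs_real_aux n hn]
  have hcard : card' (gCoeff n) = n * (n - 1) / 2 := by
    rw [← card_pairs_aux, ← Nat.card_eq_fintype_card]
    unfold card'
    symm
    refine Nat.card_congr (Equiv.ofBijective
      (fun p : Pairs n => (⟨Sum.inl (Sum.inr p), ?_⟩ : {i : Idx n // gCoeff n i ≠ 0})) ⟨?_, ?_⟩)
    · exact hc.ne'
    · intro p q h
      exact Sum.inr_injective (Sum.inl_injective (congrArg Subtype.val h))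
    · rintro ⟨(i | p) | i, h⟩
      · exact absurd rfl h
      · exact ⟨p, rfl⟩
      · exact absurd rfl h
  have hsum : (∑ ι, gCoeff n ι * psi n Δ ι (fun _ => Δ)) =
      3 * Real.sqrt ((n : ℝ) * ((n : ℝ) - 1) / 2) := by
    have h3 : 3 / Δ ^ 2 * (Δ * Δ) = 3 := by field_simp
    have hs : Real.sqrt (2 / ((n : ℝ) * ((n : ℝ) - 1))) =
        (Real.sqrt ((n : ℝ) * ((n : ℝ) - 1) / 2))⁻¹ := by
      rw [← Real.sqrt_inv, inv_div]
    have hpos : 0 < Real.sqrt ((n : ℝ) * ((n : ℝ) - 1) / 2) :=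
      Real.sqrt_pos.mpr (by linarith)
    have hsq := Real.sq_sqrt (show 0 ≤ (n : ℝ) * ((n : ℝ) - 1) / 2 by linarith)
    rw [Fintype.sum_sum_type, Fintype.sum_sum_type]
    simp only [gCoeff, psi, Sum.elim_inl, Sum.elim_inr, Pi.zero_apply, zero_mul,
      Finset.sum_const_zero, zero_add, add_zero, h3, Finset.sum_const, Finset.card_univ,
      nsmul_eq_mul]
    rw [hP, hs]
    set s := Real.sqrt ((n : ℝ) * ((n : ℝ) - 1) / 2)
    rw [← hsq]
    field_simp
  refine ⟨?_, hcard, hsum, ?_⟩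
  · unfold l2
    rw [Real.sqrt_eq_one, Fintype.sum_sum_type, Fintype.sum_sum_type]
    simp only [gCoeff, Sum.elim_inl, Sum.elim_inr, Pi.zero_apply, ne_eq, OfNat.ofNat_ne_zero,
      not_false_eq_true, zero_pow,
      Finset.sum_const_zero, zero_add, add_zero, Finset.sum_const, Finset.card_univ,
      nsmul_eq_mul]
    rw [hP, Real.sq_sqrt (div_pos two_pos hN).le]
    generalize (n : ℝ) * ((n : ℝ) - 1) = N at hN
    field_simp
  · rw [hsum, hcard, card_pairs_real_aux n hn]
end
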